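/- Set t = ⌈√d⌉ and k = 100000, and let p be the uniform distribution on a set A of cardinality d (within some finite type X). Let M be the block-averaged collision count from kt i.i.d. samples from p. Then there exists d₀ such that for all d ≥ d₀, the probability that |M − C(t,2)·2/(d+1)| > 1/4 is at least 0.99, where C(t,2) is the binomial coefficient 't choose 2'. (This is the key step showing that measurement outcomes of a full-support stabilizer state yield noticeably fewer collisions than a Haar-random state.) -/

import Mathlib

open MeasureTheory
open scoped Classical

noncomputable section

/-- The number of colliding pairs `M^(r)` within block `r` of the samples `ω`. -/
def blockCollisions {X : Type*} (k t : ℕ) (r : Fin k) (ω : Fin k × Fin t → X) : ℝ :=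
  ((Finset.univ.filter fun ij : Fin t × Fin t =>
      ij.1 < ij.2 ∧ ω (r, ij.1) = ω (r, ij.2)).card : ℝ)

/-- The block average `M = (1/k)·Σ_r M^(r)`. -/
def blockAvg {X : Type*} (k t : ℕ) (ω : Fin k × Fin t → X) : ℝ :=
  (k : ℝ)⁻¹ * ∑ r : Fin k, blockCollisions k t r ω

/-- Resampling one coordinate of a product of copies of `μ` preserves the product measure. -/
theorem measurePreserving_update_pi {ι X : Type*} [Fintype ι] [MeasurableSpace X]
    (μ : Measure X) [IsProbabilityMeasure μ] (v : ι) :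
    MeasurePreserving (fun z : (ι → X) × X => Function.update z.1 v z.2)
      ((Measure.pi fun _ : ι => μ).prod μ) (Measure.pi fun _ : ι => μ) := by
  have hm : Measurable (fun z : (ι → X) × X => Function.update z.1 v z.2) := by
    refine measurable_pi_lambda _ fun i => ?_
    by_cases h : i = v
    · subst h
      simpa using measurable_snd
    · simpa [h, Function.comp_def] using (measurable_pi_apply i).comp measurable_fst
  refine ⟨hm, (Measure.pi_eq fun s hs => ?_).symm⟩
  rw [Measure.map_apply hm (MeasurableSet.univ_pi hs)]
  have hpre : (fun z : (ι → X) × X => Function.update z.1 v z.2) ⁻¹' Set.univ.pi s =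
      Set.univ.pi (Function.update s v Set.univ) ×ˢ s v := by
    ext ⟨ω, x⟩
    simp only [Set.mem_preimage, Set.mem_univ_pi, Set.mem_prod]
    refine ⟨fun h => ⟨fun i => ?_, by simpa using h v⟩, fun h i => ?_⟩
    · by_cases hi : i = v
      · subst hi
        simp
      · simpa [hi] using h i
    · by_cases hi : i = v
      · subst hi
        simpa using h.2
      · simpa [hi] using h.1 i
  rw [hpre, Measure.prod_prod, Measure.pi_pi,
    ← Finset.prod_erase_mul Finset.univ (fun i => μ (s i)) (Finset.mem_univ v),
    ← Finset.prod_erase_mul Finset.univ _ (Finset.mem_univ v)]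
  simp only [Function.update_self, measure_univ, mul_one]
  congr 1
  refine Finset.prod_congr rfl fun i hi => ?_
  rw [Function.update_of_ne (Finset.ne_of_mem_erase hi)]

/-- The indicator of a collision between coordinates `a` and `b`, shifted by `q`. -/
def shiftedCollision {ι X : Type*} (q : ℝ) (a b : ι) (ω : ι → X) : ℝ :=
  (if ω a = ω b then 1 else 0) - q

theorem shiftedCollision_comm {ι X : Type*} (q : ℝ) (a b : ι) (ω : ι → X) :
    shiftedCollision q a b ω = shiftedCollision q b a ω := by
  simp only [shiftedCollision, eq_comm]

theorem shiftedCollision_update {ι X : Type*} (q : ℝ) {a c d : ι} (hc : c ≠ a) (hd : d ≠ a)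
    (ω : ι → X) (x : X) :
    shiftedCollision q c d (Function.update ω a x) = shiftedCollision q c d ω := by
  simp only [shiftedCollision, Function.update_of_ne hc, Function.update_of_ne hd]

section Uniform

variable {ι X : Type*} [Fintype ι] [Fintype X] [MeasurableSpace X] [MeasurableSingletonClass X]
  (A : Finset X) (hA : A.Nonempty)

/-- The law of independent uniform samples from `A` indexed by `ι`. -/
abbrev uniformSamples (ι : Type*) [Fintype ι] (A : Finset X) (hA : A.Nonempty) :
    Measure (ι → X) :=
  Measure.pi fun _ : ι => (PMF.uniformOfFinset A hA).toMeasure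

theorem ae_mem_uniformSamples (w : ι) : ∀ᵐ ω ∂uniformSamples ι A hA, ω w ∈ A := by
  have h : ∀ᵐ x ∂(PMF.uniformOfFinset A hA).toMeasure, x ∈ A := by
    rw [ae_iff, PMF.toMeasure_apply_eq_zero_iff _ (Set.toFinite _).measurableSet,
      PMF.support_uniformOfFinset]
    exact Set.disjoint_left.2 fun x hx hx' => hx' hx
  exact (Measure.quasiMeasurePreserving_eval
    (μ := fun _ : ι => (PMF.uniformOfFinset A hA).toMeasure) w).ae h

theorem integral_collision_uniform {y : X} (hy : y ∈ A) :
    ∫ x, ((if x = y then 1 else 0) - (A.card : ℝ)⁻¹) ∂(PMF.uniformOfFinset A hA).toMeasure = 0 := by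
  rw [integral_sub Integrable.of_finite Integrable.of_finite]
  have : (fun x : X => if x = y then (1 : ℝ) else 0) = Set.indicator {y} 1 := by
    ext x
    simp [Set.indicator_apply]
  rw [this, integral_indicator_one (measurableSet_singleton y)]
  simp [Measure.real, PMF.toMeasure_apply_singleton _ _ (measurableSet_singleton y), hy]

theorem integral_shiftedCollision_mul {a b : ι} (hab : a ≠ b) (g : (ι → X) → ℝ)
    (hg : ∀ ω x, g (Function.update ω a x) = g ω) :
    ∫ ω, shiftedCollision (A.card : ℝ)⁻¹ a b ω * g ω ∂uniformSamples ι A hA = 0 := by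
  have hmp := measurePreserving_update_pi (PMF.uniformOfFinset A hA).toMeasure a
  rw [uniformSamples, ← hmp.map_eq, integral_map hmp.measurable.aemeasurable
      (measurable_of_finite _).aestronglyMeasurable, integral_prod _ Integrable.of_finite]
  refine integral_eq_zero_of_ae ?_
  filter_upwards [ae_mem_uniformSamples A hA b] with ω hω
  simp only [shiftedCollision, hg, Function.update_self, Function.update_of_ne hab.symm,
    integral_mul_const, integral_collision_uniform A hA hω, zero_mul, Pi.zero_apply]

/-- Collisions at two different pairs of coordinates are uncorrelated. -/
theorem integral_shiftedCollision_mul_shiftedCollision {a b c d : ι} (hab : a ≠ b)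
    (h : s(a, b) ≠ s(c, d)) :
    ∫ ω, shiftedCollision (A.card : ℝ)⁻¹ a b ω * shiftedCollision (A.card : ℝ)⁻¹ c d ω
      ∂uniformSamples ι A hA = 0 := by
  by_cases ha : c ≠ a ∧ d ≠ a
  · exact integral_shiftedCollision_mul A hA hab _ (shiftedCollision_update _ ha.1 ha.2)
  · simp only [shiftedCollision_comm _ a b]
    refine integral_shiftedCollision_mul A hA hab.symm _ (shiftedCollision_update _ ?_ ?_) <;>
    · rintro rfl
      simp only [ne_eq, Sym2.eq_iff] at h
      grind

theorem integral_shiftedCollision_sq {a b : ι} (hab : a ≠ b) :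
    ∫ ω, shiftedCollision (A.card : ℝ)⁻¹ a b ω * shiftedCollision (A.card : ℝ)⁻¹ a b ω
      ∂uniformSamples ι A hA = (A.card : ℝ)⁻¹ - (A.card : ℝ)⁻¹ ^ 2 := by
  have hsq : ∀ ω : ι → X,
      shiftedCollision (A.card : ℝ)⁻¹ a b ω * shiftedCollision (A.card : ℝ)⁻¹ a b ω =
      shiftedCollision (A.card : ℝ)⁻¹ a b ω * (1 - 2 * (A.card : ℝ)⁻¹) +
        ((A.card : ℝ)⁻¹ - (A.card : ℝ)⁻¹ ^ 2) := by
    intro ω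
    unfold shiftedCollision
    split_ifs <;> ring
  simp only [hsq]
  rw [integral_add Integrable.of_finite Integrable.of_finite,
    integral_shiftedCollision_mul A hA hab _ fun _ _ => rfl]
  simp

theorem integral_sum_shiftedCollision_sq {κ : Type*} (P : Finset κ) (u v : κ → ι)
    (huv : ∀ e ∈ P, u e ≠ v e)
    (hinj : ∀ e ∈ P, ∀ f ∈ P, e ≠ f → s(u e, v e) ≠ s(u f, v f)) :
    ∫ ω, (∑ e ∈ P, shiftedCollision (A.card : ℝ)⁻¹ (u e) (v e) ω) ^ 2 ∂uniformSamples ι A hA =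
      P.card * ((A.card : ℝ)⁻¹ - (A.card : ℝ)⁻¹ ^ 2) := by
  simp only [sq (∑ e ∈ P, _), Finset.sum_mul_sum]
  rw [integral_finsetSum _ fun _ _ => Integrable.of_finite, ← nsmul_eq_mul]
  refine Finset.sum_eq_card_nsmul fun e he => ?_
  rw [integral_finsetSum _ fun _ _ => Integrable.of_finite, Finset.sum_eq_single_of_mem e he,
    integral_shiftedCollision_sq A hA (huv e he)]
  intro f hf hfe
  exact integral_shiftedCollision_mul_shiftedCollision A hA (huv e he) (hinj e he f hf hfe.symm)

end Uniform

theorem card_filter_fin_lt (t : ℕ) :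
    (Finset.univ.filter fun ij : Fin t × Fin t => ij.1 < ij.2).card = t.choose 2 := by
  rw [Finset.card_filter, Fintype.sum_prod_type_right, Nat.choose_two_right,
    ← Finset.sum_range_id, Finset.sum_range]
  refine Finset.sum_congr rfl fun j _ => ?_
  rw [← Finset.card_filter, Finset.filter_gt_eq_Iio, Fin.card_Iio]

theorem blockAvg_sub {X : Type*} (k t : ℕ) (hk : k ≠ 0) (q : ℝ) (ω : Fin k × Fin t → X) :
    blockAvg k t ω - t.choose 2 * q = (k : ℝ)⁻¹ *
      ∑ e ∈ (Finset.univ : Finset (Fin k)) ×ˢ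
          (Finset.univ.filter fun ij : Fin t × Fin t => ij.1 < ij.2),
        shiftedCollision q (e.1, e.2.1) (e.1, e.2.2) ω := by
  have hk' : (k : ℝ) ≠ 0 := Nat.cast_ne_zero.2 hk
  have hblock : ∀ r : Fin k, blockCollisions k t r ω - t.choose 2 * q =
      ∑ ij ∈ Finset.univ.filter (fun ij : Fin t × Fin t => ij.1 < ij.2),
        shiftedCollision q (r, ij.1) (r, ij.2) ω := by
    intro r
    simp only [shiftedCollision, Finset.sum_sub_distrib, Finset.sum_const, nsmul_eq_mul,
      card_filter_fin_lt, blockCollisions, Finset.sum_boole, Finset.filter_filter]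
  rw [Finset.sum_product]
  simp only [← hblock, Finset.sum_sub_distrib, Finset.sum_const, Finset.card_univ,
    Fintype.card_fin, nsmul_eq_mul, blockAvg]
  field_simp

/-- Second moment of the block average around its mean `C(t,2)/d`. -/
theorem integral_blockAvg_sub_sq {X : Type*} [Fintype X] [MeasurableSpace X]
    [MeasurableSingletonClass X] (A : Finset X) (hA : A.Nonempty) (k t : ℕ) (hk : k ≠ 0) :
    ∫ ω, (blockAvg k t ω - t.choose 2 * (A.card : ℝ)⁻¹) ^ 2 ∂uniformSamples (Fin k × Fin t) A hA =
      (k : ℝ)⁻¹ * (t.choose 2 * ((A.card : ℝ)⁻¹ - (A.card : ℝ)⁻¹ ^ 2)) := by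
  have hk' : (k : ℝ) ≠ 0 := Nat.cast_ne_zero.2 hk
  simp only [blockAvg_sub k t hk, mul_pow]
  rw [integral_const_mul, integral_sum_shiftedCollision_sq A hA _
    (fun e : Fin k × Fin t × Fin t => (e.1, e.2.1)) (fun e => (e.1, e.2.2)),
    Finset.card_product, card_filter_fin_lt, Finset.card_univ, Fintype.card_fin, Nat.cast_mul]
  · field_simp
  · rintro ⟨r, i, j⟩ he
    simp only [Finset.mem_product, Finset.mem_filter] at he
    simpa using he.2.2.ne
  · rintro ⟨r, i, j⟩ he ⟨r', i', j'⟩ hf hne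
    simp only [Finset.mem_product, Finset.mem_filter, Finset.mem_univ, true_and] at he hf
    simp only [ne_eq, Sym2.eq_iff, Prod.mk.injEq] at hne ⊢
    rintro (⟨⟨rfl, rfl⟩, -, rfl⟩ | ⟨⟨rfl, rfl⟩, -, rfl⟩)
    · exact hne ⟨rfl, rfl, rfl⟩
    · exact lt_asymm he hf

/-- Chebyshev's inequality for the block average. -/
theorem measureReal_blockAvg_sub_ge_le {X : Type*} [Fintype X] [MeasurableSpace X]
    [MeasurableSingletonClass X] (A : Finset X) (hA : A.Nonempty) (k t : ℕ) (hk : k ≠ 0)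
    {ε : ℝ} (hε : 0 < ε) :
    (uniformSamples (Fin k × Fin t) A hA).real
        {ω | ε ≤ |blockAvg k t ω - t.choose 2 * (A.card : ℝ)⁻¹|} ≤
      (k : ℝ)⁻¹ * (t.choose 2 * (A.card : ℝ)⁻¹) / ε ^ 2 := by
  have hmarkov := mul_meas_ge_le_integral_of_nonneg (μ := uniformSamples (Fin k × Fin t) A hA)
    (f := fun ω => (blockAvg k t ω - t.choose 2 * (A.card : ℝ)⁻¹) ^ 2)
    (Filter.Eventually.of_forall fun _ => sq_nonneg _) Integrable.of_finite (ε ^ 2)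
  have hset : {ω : Fin k × Fin t → X | ε ^ 2 ≤ (blockAvg k t ω - t.choose 2 * (A.card : ℝ)⁻¹) ^ 2} =
      {ω | ε ≤ |blockAvg k t ω - t.choose 2 * (A.card : ℝ)⁻¹|} := by
    ext ω
    simp only [Set.mem_ofPred_eq, sq_le_sq, abs_of_pos hε]
  rw [hset, integral_blockAvg_sub_sq A hA k t hk] at hmarkov
  rw [le_div_iff₀' (by positivity)]
  refine hmarkov.trans ?_
  gcongr
  exact sub_le_self _ (by positivity)

theorem choose_two_ceil_sqrt_bounds (d : ℕ) (hd : 1 ≤ d) :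
    Real.sqrt d * (Real.sqrt d - 1) / 2 ≤ (⌈Real.sqrt d⌉₊.choose 2 : ℝ) ∧
      (⌈Real.sqrt d⌉₊.choose 2 : ℝ) ≤ d := by
  have hs : 1 ≤ Real.sqrt d := Real.one_le_sqrt.2 (by exact_mod_cast hd)
  have hsq : Real.sqrt d * Real.sqrt d = d := Real.mul_self_sqrt (Nat.cast_nonneg d)
  have h₁ := Nat.le_ceil (Real.sqrt d)
  have h₂ := Nat.ceil_lt_add_one (Real.sqrt_nonneg d)
  rw [Nat.cast_choose_two]
  constructor <;> nlinarith

/-- For `t = ⌈√d⌉` and `k = 100000`: for `kt` i.i.d. samples from the uniform distribution on a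
set `A` of cardinality `d`, the block-averaged collision count `M` satisfies
`|M - C(t,2)·2/(d+1)| > 1/4` with probability at least `0.99`, for all sufficiently large `d`. -/
theorem uniform_collision_test :
    ∃ d₀ : ℕ, ∀ d : ℕ, d₀ ≤ d →
      ∀ (X : Type) [Fintype X] [MeasurableSpace X] [MeasurableSingletonClass X]
        (A : Finset X) (hA : A.Nonempty), A.card = d →
        ENNReal.ofReal (99 / 100) ≤
          (Measure.pi fun _ : Fin 100000 × Fin ⌈Real.sqrt d⌉₊ =>
              (PMF.uniformOfFinset A hA).toMeasure)
            {ω | 1 / 4 < |blockAvg 100000 ⌈Real.sqrt d⌉₊ ω -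
                ((⌈Real.sqrt d⌉₊.choose 2 : ℝ) * (2 / ((d : ℝ) + 1)))|} := by
  refine ⟨10000, fun d hd X _ _ _ A hA hcard => ?_⟩
  obtain ⟨hlow, hup⟩ := choose_two_ceil_sqrt_bounds d (by omega)
  have hcheb := measureReal_blockAvg_sub_ge_le A hA 100000 ⌈Real.sqrt d⌉₊ (by norm_num)
    (ε := 1 / 5) (by norm_num)
  rw [hcard] at hcheb
  generalize ⌈Real.sqrt d⌉₊ = t at *
  have hdR : (10000 : ℝ) ≤ d := by exact_mod_cast hd
  have hs : 100 ≤ Real.sqrt d := Real.le_sqrt_of_sq_le (by linarith)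
  have hsq : Real.sqrt d * Real.sqrt d = d := Real.mul_self_sqrt (Nat.cast_nonneg d)
  have hmean : (t.choose 2 : ℝ) * (d : ℝ)⁻¹ ≤ 1 := by
    rw [← div_eq_mul_inv]
    exact div_le_one_of_le₀ hup (by positivity)
  have hgap : 9 / 20 ≤ (t.choose 2 : ℝ) * (2 / ((d : ℝ) + 1)) - t.choose 2 * (d : ℝ)⁻¹ := by
    have hlow' : 99 / 200 * (d : ℝ) ≤ t.choose 2 := by nlinarith
    have : (t.choose 2 : ℝ) * (2 / ((d : ℝ) + 1)) - t.choose 2 * (d : ℝ)⁻¹ =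
        t.choose 2 * (d - 1) / (d * (d + 1)) := by
      field_simp
      ring
    rw [this, le_div_iff₀ (by positivity)]
    nlinarith
  have hbad : (uniformSamples (Fin 100000 × Fin t) A hA).real
      {ω | 1 / 5 ≤ |blockAvg 100000 t ω - t.choose 2 * (d : ℝ)⁻¹|} ≤ 1 / 100 := by
    refine hcheb.trans ?_
    norm_num
    linarith
  have hcompl := probReal_compl_eq_one_sub (μ := uniformSamples (Fin 100000 × Fin t) A hA)
    (s := {ω | 1 / 5 ≤ |blockAvg 100000 t ω - t.choose 2 * (d : ℝ)⁻¹|})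
    (Set.toFinite _).measurableSet
  refine (ENNReal.ofReal_le_iff_le_toReal (measure_ne_top _ _)).2 ?_
  refine le_trans (by linarith) (measureReal_mono (μ := uniformSamples (Fin 100000 × Fin t) A hA)
    (s₁ := {ω | 1 / 5 ≤ |blockAvg 100000 t ω - t.choose 2 * (d : ℝ)⁻¹|}ᶜ) ?_)
  intro ω hω
  simp only [Set.mem_compl_iff, Set.mem_ofPred_eq, not_le] at hω ⊢
  rw [lt_abs]
  right
  linarith [(abs_lt.1 hω).2]
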